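/- arXiv:2406.20034 — 2 statements merged into one kernel-verified Lean document; each statement's English description precedes it below -/
import Mathlib

section
/- Let A be an MLUB-complete bounded poset and (T,R) a time frame. For nonempty C, D ⊆ A^T, let U(C) and L(D) denote the upper and lower cones computed in the pointwise-ordered poset A^T, and write C(t) = {q(t) : q ∈ C}, D(t) = {q(t) : q ∈ D}. Then for all s ∈ T: (i) Max(⋂{LU(C(t)) : t ∈ T, s R t}) = G(U(C))(s) = G(Min U(C))(s); (ii) LU(⋃{L(D(t)) : t ∈ T, t R s}) = L(P(L(D))(s)) = L(P(Max L(D))(s)); (iii) Max(⋂{LU(C(t)) : t ∈ T, t R s}) = H(U(C))(s) = H(Min U(C))(s); (iv) LU(⋃{L(D(t)) : t ∈ T, s R t}) = L(F(L(D))(s)) = L(F(Max L(D))(s)). (The left-hand sides are the values at s of the operators Ĝ, P̂, Ĥ, F̂ constructed from (T,R) on the Dedekind–MacNeille completion DM(A) = {X ⊆ A : LU(X) = X}, applied to the families t ↦ LU(C(t)), respectively t ↦ L(D(t)).) -/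
open Set

section Defs

variable {α T : Type*}

/-- The set of maximal elements of a subset of a poset. -/
def maxSet [PartialOrder α] (X : Set α) : Set α :=
  {a | a ∈ X ∧ ∀ b ∈ X, a ≤ b → a = b}

/-- The set of minimal elements of a subset of a poset. -/
def minSet [PartialOrder α] (X : Set α) : Set α :=
  {a | a ∈ X ∧ ∀ b ∈ X, b ≤ a → a = b}

/-- MUB-complete: below every upper bound of a nonempty set there is a minimal upper bound. -/
def MUBComplete (α : Type*) [PartialOrder α] : Prop :=
  ∀ M : Set α, M.Nonempty → ∀ x ∈ upperBounds M, ∃ m ∈ minSet (upperBounds M), m ≤ x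

/-- MLB-complete: above every lower bound of a nonempty set there is a maximal lower bound. -/
def MLBComplete (α : Type*) [PartialOrder α] : Prop :=
  ∀ M : Set α, M.Nonempty → ∀ x ∈ lowerBounds M, ∃ m ∈ maxSet (lowerBounds M), x ≤ m

def MLUBComplete (α : Type*) [PartialOrder α] : Prop :=
  MUBComplete α ∧ MLBComplete α

/-- X ≤ Y : all-pairs comparison of subsets. -/
def leS [LE α] (X Y : Set α) : Prop := ∀ x ∈ X, ∀ y ∈ Y, x ≤ y

/-- X ≤₁ Y : every x ∈ X is below some y ∈ Y. -/
def le1 [LE α] (X Y : Set α) : Prop := ∀ x ∈ X, ∃ y ∈ Y, x ≤ y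

/-- X ≤₂ Y : every y ∈ Y is above some x ∈ X. -/
def le2 [LE α] (X Y : Set α) : Prop := ∀ y ∈ Y, ∃ x ∈ X, x ≤ y

/-- A binary relation is serial if every point has a predecessor and a successor. -/
def Serial (R : T → T → Prop) : Prop := ∀ s, (∃ r, R r s) ∧ (∃ t, R s t)

/-- B(s) = {q(s) : q ∈ B}. -/
def evalAt (s : T) (B : Set (T → α)) : Set α := (fun q => q s) '' B

/-- Tense operator P(B)(s) = Min U({q(t) : q ∈ B, t R s}). -/
def tP [PartialOrder α] (R : T → T → Prop) (B : Set (T → α)) (s : T) : Set α :=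
  minSet (upperBounds {x | ∃ q ∈ B, ∃ t, R t s ∧ x = q t})

/-- Tense operator F(B)(s) = Min U({q(t) : q ∈ B, s R t}). -/
def tF [PartialOrder α] (R : T → T → Prop) (B : Set (T → α)) (s : T) : Set α :=
  minSet (upperBounds {x | ∃ q ∈ B, ∃ t, R s t ∧ x = q t})

/-- Tense operator H(B)(s) = Max L({q(t) : q ∈ B, t R s}). -/
def tH [PartialOrder α] (R : T → T → Prop) (B : Set (T → α)) (s : T) : Set α :=
  maxSet (lowerBounds {x | ∃ q ∈ B, ∃ t, R t s ∧ x = q t})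

/-- Tense operator G(B)(s) = Max L({q(t) : q ∈ B, s R t}). -/
def tG [PartialOrder α] (R : T → T → Prop) (B : Set (T → α)) (s : T) : Set α :=
  maxSet (lowerBounds {x | ∃ q ∈ B, ∃ t, R s t ∧ x = q t})

/-- The transformation function φ. -/
def phi (B : T → Set α) : Set (T → α) := {q | ∀ t, q t ∈ B t}

end Defs

theorem exMin {α T : Type*} [PartialOrder α] (h : MUBComplete α) (C : Set (T → α))
    (hC : C.Nonempty) (q : T → α) (hq : q ∈ upperBounds C) :
    ∃ m ∈ minSet (upperBounds C), m ≤ q := by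
  have key : ∀ t, ∃ m ∈ minSet (upperBounds (evalAt t C)), m ≤ q t := fun t =>
    h _ (hC.image _) _ (by rintro _ ⟨c, hc, rfl⟩; exact hq hc t)
  choose m hm hmq using key
  refine ⟨m, ⟨fun c hc t => (hm t).1 ⟨c, hc, rfl⟩, fun b hb hbm => ?_⟩, hmq⟩
  funext t
  exact (hm t).2 _ (by rintro _ ⟨c, hc, rfl⟩; exact hb hc t) (hbm t)

theorem exMax {α T : Type*} [PartialOrder α] (h : MLBComplete α) (C : Set (T → α))
    (hC : C.Nonempty) (q : T → α) (hq : q ∈ lowerBounds C) :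
    ∃ m ∈ maxSet (lowerBounds C), q ≤ m := by
  have key : ∀ t, ∃ m ∈ maxSet (lowerBounds (evalAt t C)), q t ≤ m := fun t =>
    h _ (hC.image _) _ (by rintro _ ⟨c, hc, rfl⟩; exact hq hc t)
  choose m hm hmq using key
  refine ⟨m, ⟨fun c hc t => (hm t).1 ⟨c, hc, rfl⟩, fun b hb hbm => ?_⟩, hmq⟩
  funext t
  exact (hm t).2 _ (by rintro _ ⟨c, hc, rfl⟩; exact hb hc t) (hbm t)

theorem low1 {α T : Type*} [PartialOrder α] [BoundedOrder α] (S : T → Prop) (C : Set (T → α)) :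
    (⋂ t ∈ {t | S t}, lowerBounds (upperBounds (evalAt t C))) =
      lowerBounds {x | ∃ q ∈ upperBounds C, ∃ t, S t ∧ x = q t} := by
  classical
  ext x
  simp only [mem_iInter, mem_setOf_eq]
  constructor
  · rintro hx _ ⟨q, hq, t, ht, rfl⟩
    exact hx t ht (by rintro _ ⟨c, hc, rfl⟩; exact hq hc t)
  · intro hx t ht u hu
    refine hx ⟨Function.update (fun _ => ⊤) t u, ?_, t, ht, by simp⟩
    intro c hc r
    by_cases hr : r = t
    · subst hr
      simpa using hu ⟨c, hc, rfl⟩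
    · simp [hr]

theorem low2 {α T : Type*} [PartialOrder α] (h : MUBComplete α) (S : T → Prop)
    (C : Set (T → α)) (hC : C.Nonempty) :
    lowerBounds {x | ∃ q ∈ upperBounds C, ∃ t, S t ∧ x = q t} =
      lowerBounds {x | ∃ q ∈ minSet (upperBounds C), ∃ t, S t ∧ x = q t} := by
  ext x
  constructor
  · rintro hx _ ⟨q, hq, t, ht, rfl⟩
    exact hx ⟨q, hq.1, t, ht, rfl⟩
  · rintro hx _ ⟨q, hq, t, ht, rfl⟩
    obtain ⟨m, hm, hmq⟩ := exMin h C hC q hq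
    exact (hx ⟨m, hm, t, ht, rfl⟩).trans (hmq t)

theorem up1 {α T : Type*} [PartialOrder α] [BoundedOrder α] (S : T → Prop) (D : Set (T → α)) :
    upperBounds (⋃ t ∈ {t | S t}, lowerBounds (evalAt t D)) =
      upperBounds {x | ∃ q ∈ lowerBounds D, ∃ t, S t ∧ x = q t} := by
  classical
  congr 1
  ext x
  simp only [mem_iUnion, mem_setOf_eq]
  constructor
  · rintro ⟨t, ht, hx⟩
    refine ⟨Function.update (fun _ => ⊥) t x, ?_, t, ht, by simp⟩
    intro c hc r
    by_cases hr : r = t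
    · subst hr
      simpa using hx ⟨c, hc, rfl⟩
    · simp [hr]
  · rintro ⟨q, hq, t, ht, rfl⟩
    exact ⟨t, ht, by rintro _ ⟨c, hc, rfl⟩; exact hq hc t⟩

theorem up2 {α T : Type*} [PartialOrder α] (h : MLBComplete α) (S : T → Prop)
    (D : Set (T → α)) (hD : D.Nonempty) :
    upperBounds {x | ∃ q ∈ lowerBounds D, ∃ t, S t ∧ x = q t} =
      upperBounds {x | ∃ q ∈ maxSet (lowerBounds D), ∃ t, S t ∧ x = q t} := by
  ext x
  constructor
  · rintro hx _ ⟨q, hq, t, ht, rfl⟩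
    exact hx ⟨q, hq.1, t, ht, rfl⟩
  · rintro hx _ ⟨q, hq, t, ht, rfl⟩
    obtain ⟨m, hm, hmq⟩ := exMax h D hD q hq
    exact (hmq t).trans (hx ⟨m, hm, t, ht, rfl⟩)

theorem lowMin {α : Type*} [PartialOrder α] [BoundedOrder α] (h : MUBComplete α) (X : Set α) :
    lowerBounds (upperBounds X) = lowerBounds (minSet (upperBounds X)) := by
  ext x
  constructor
  · exact fun hx y hy => hx hy.1
  · intro hx y hy
    rcases X.eq_empty_or_nonempty with rfl | hX
    · have : (⊥ : α) ∈ minSet (upperBounds (∅ : Set α)) :=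
        ⟨by simp, fun b _ hb => (le_bot_iff.1 hb).symm⟩
      exact (hx this).trans bot_le
    · obtain ⟨m, hm, hmy⟩ := h X hX y hy
      exact (hx hm).trans hmy

/-- Theorem 4.1: connection between the tense operators and the operators
Ĝ, P̂, Ĥ, F̂ on the Dedekind-MacNeille completion. -/
theorem stmt14 {α T : Type*} [PartialOrder α] [BoundedOrder α] [Nonempty T]
    (h : MLUBComplete α) (R : T → T → Prop)
    (C D : Set (T → α)) (hC : C.Nonempty) (hD : D.Nonempty) (s : T) :
    (maxSet (⋂ t ∈ {t | R s t}, lowerBounds (upperBounds (evalAt t C))) =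
        tG R (upperBounds C) s ∧
      tG R (upperBounds C) s = tG R (minSet (upperBounds C)) s) ∧
    (lowerBounds (upperBounds (⋃ t ∈ {t | R t s}, lowerBounds (evalAt t D))) =
        lowerBounds (tP R (lowerBounds D) s) ∧
      lowerBounds (tP R (lowerBounds D) s) =
        lowerBounds (tP R (maxSet (lowerBounds D)) s)) ∧
    (maxSet (⋂ t ∈ {t | R t s}, lowerBounds (upperBounds (evalAt t C))) =
        tH R (upperBounds C) s ∧
      tH R (upperBounds C) s = tH R (minSet (upperBounds C)) s) ∧
    (lowerBounds (upperBounds (⋃ t ∈ {t | R s t}, lowerBounds (evalAt t D))) =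
        lowerBounds (tF R (lowerBounds D) s) ∧
      lowerBounds (tF R (lowerBounds D) s) =
        lowerBounds (tF R (maxSet (lowerBounds D)) s)) := by
  refine ⟨⟨?_, ?_⟩, ⟨?_, ?_⟩, ⟨?_, ?_⟩, ⟨?_, ?_⟩⟩
  · rw [low1 (fun t => R s t)]; rfl
  · unfold tG; rw [low2 h.1 (fun t => R s t) C hC]
  · rw [up1 (fun t => R t s), lowMin h.1]; rfl
  · unfold tP; rw [up2 h.2 (fun t => R t s) D hD]
  · rw [low1 (fun t => R t s)]; rfl
  · unfold tH; rw [low2 h.1 (fun t => R t s) C hC]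
  · rw [up1 (fun t => R s t), lowMin h.1]; rfl
  · unfold tF; rw [up2 h.2 (fun t => R s t) D hD]
end

section
/- Let A be a bounded poset satisfying both the ACC and the DCC, and (T,R) a time frame with R serial. Order A^T pointwise, and in the poset A^T define, for b, c ∈ A^T, b⊙c = Max L({b,c}), and for a nonempty B ⊆ A^T, B⊙B = Max LU(⋃{b⊙c : b, c ∈ B}) (cones, Max and LU computed in A^T). Then for the tense operators P and F induced by (T,R): P(B⊙B) = P(B) and F(B⊙B) = F(B), as functions of s ∈ T. -/
open Set

/-- The "unsharp" conjunction: x ⊙ y = Max L({x,y}). -/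
def odot {α : Type*} [PartialOrder α] (x y : α) : Set α :=
  maxSet (lowerBounds {x, y})

/-- The "unsharp" implication: x → y = Max {z : x ⊙ z ≤ y}. -/
def implS {α : Type*} [PartialOrder α] (x y : α) : Set α :=
  maxSet {z | ∀ v ∈ odot x z, v ≤ y}

/-- Extension of ⊙ to subsets: B ⊙ C = Max LU(⋃ {b ⊙ c : b ∈ B, c ∈ C}). -/
def odotS {α : Type*} [PartialOrder α] (B C : Set α) : Set α :=
  maxSet (lowerBounds (upperBounds (⋃ b ∈ B, ⋃ c ∈ C, odot b c)))

theorem exists_max_above {α : Type*} [PartialOrder α] [WellFoundedGT α]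
    (X : Set α) (x : α) (hx : x ∈ X) : ∃ m ∈ maxSet X, x ≤ m := by
  obtain ⟨m, ⟨hm, hxm⟩, h⟩ := (wellFounded_gt (α := α)).has_min {y | y ∈ X ∧ x ≤ y} ⟨x, hx, le_rfl⟩
  refine ⟨m, ⟨hm, fun b hb hmb => ?_⟩, hxm⟩
  by_contra hne
  exact h b ⟨hb, hxm.trans hmb⟩ (lt_of_le_of_ne hmb hne)

theorem ub_odot {β : Type*} [PartialOrder β] (B : Set β) :
    upperBounds (⋃ b ∈ B, ⋃ c ∈ B, odot b c) = upperBounds B := by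
  ext u
  constructor
  · intro h b hb
    apply h
    simp only [mem_iUnion]
    refine ⟨b, hb, b, hb, ?_, ?_⟩
    · simp [lowerBounds]
    · intro c hc hbc
      exact le_antisymm hbc (hc (by simp))
  · intro h v hv
    simp only [mem_iUnion] at hv
    obtain ⟨b, hb, c, hc, hv, -⟩ := hv
    exact (hv (by simp : b ∈ ({b, c} : Set β))).trans (h hb)

theorem ub_eq {α T : Type*} [PartialOrder α] [BoundedOrder α]
    [WellFoundedGT α] (S : T → Prop) (B : Set (T → α)) :
    upperBounds {x | ∃ q ∈ odotS B B, ∃ t, S t ∧ x = q t} =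
      upperBounds {x | ∃ q ∈ B, ∃ t, S t ∧ x = q t} := by
  classical
  have key : ∀ m ∈ lowerBounds (upperBounds B), ∀ t, ∀ u : α, (∀ q ∈ B, q t ≤ u) → m t ≤ u := by
    intro m hm t u hu
    have := hm (a := Function.update (fun _ => ⊤) t u) (by
      intro q hq s
      by_cases h : s = t
      · subst h; simpa using hu q hq
      · simp [Function.update_of_ne h]) t
    simpa using this
  unfold odotS
  rw [ub_odot]
  ext u
  constructor
  · rintro h _ ⟨q, hq, t, ht, rfl⟩
    have h1 : ∀ t, ∃ m ∈ maxSet {a : α | ∀ v, (∀ p ∈ B, p t ≤ v) → a ≤ v}, q t ≤ m :=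
      fun t => exists_max_above _ _ (fun v hv => hv q hq)
    choose m hm hqm using h1
    refine (hqm t).trans (h ⟨m, ⟨?_, ?_⟩, t, ht, rfl⟩)
    · intro w hw s
      exact (hm s).1 _ (fun p hp => hw hp s)
    · intro b hb hmb
      funext s
      exact (hm s).2 _ (fun v hv => key b hb s v hv) (hmb s)
  · rintro h _ ⟨m, ⟨hm, -⟩, t, ht, rfl⟩
    exact key m hm t u (fun q hq => h ⟨q, hq, t, ht, rfl⟩)

/-- Theorem 6.4 (1): P(B ⊙ B) = P(B) and F(B ⊙ B) = F(B), where ⊙ is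
computed in the pointwise-ordered poset A^T. -/
theorem stmt19 {α T : Type*} [PartialOrder α] [BoundedOrder α]
    [WellFoundedGT α] [WellFoundedLT α] [Nonempty T]
    (R : T → T → Prop) (hR : Serial R)
    (B : Set (T → α)) (hB : B.Nonempty) :
    tP R (odotS B B) = tP R B ∧ tF R (odotS B B) = tF R B := by
  constructor
  · funext s
    unfold tP
    rw [ub_eq (fun t => R t s)]
  · funext s
    unfold tF
    rw [ub_eq (fun t => R s t)]
end
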